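/- Let γ ∈ (0, √2). For real α < −γ/2 the integral G(α) := ∫_{−1}^{0} ∫_{0}^{1} |x₁|^{−γα/2 − 1} |x₂|^{−γα/2 − 1} |x₁ − x₂|^{−γ²/2} dx₁ dx₂ converges absolutely. Then lim_{α ↗ −γ/2} (α + γ/2)·G(α) = −(2/γ) · cos(π γ²/4) · Γ(γ²/4) Γ(1 − γ²/2) / Γ(1 − γ²/4). -/

import Mathlib

open MeasureTheory Set

noncomputable def Gintegrand (γ α : ℝ) (p : ℝ × ℝ) : ℝ :=
  |p.1| ^ (-(γ * α) / 2 - 1) * |p.2| ^ (-(γ * α) / 2 - 1) *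
    |p.1 - p.2| ^ (-(γ ^ 2) / 2)

noncomputable def G (γ α : ℝ) : ℝ :=
  ∫ p in (Ioo (0 : ℝ) 1) ×ˢ (Ioo (-1 : ℝ) 0), Gintegrand γ α p

lemma lintegral_rpow_Ioo_zero {r b : ℝ} (hr : -1 < r) (hb : 0 ≤ b) :
    ∫⁻ x in Ioo 0 b, ENNReal.ofReal (x ^ r) = ENNReal.ofReal (b ^ (r + 1) / (r + 1)) := by
  rw [← ofReal_integral_eq_lintegral_ofReal]
  · rw [← integral_Ioc_eq_integral_Ioo, ← intervalIntegral.integral_of_le hb,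
      integral_rpow (Or.inl hr), Real.zero_rpow (by linarith), sub_zero]
  · exact (intervalIntegrable_iff_integrableOn_Ioo_of_le hb).1
      (intervalIntegral.intervalIntegrable_rpow' hr)
  · filter_upwards [ae_restrict_mem measurableSet_Ioo] with x hx
    exact Real.rpow_nonneg hx.1.le _

lemma lintegral_rpow_mul_exp_neg_mul_Ioi {a r : ℝ} (ha : 0 < a) (hr : 0 < r) :
    ∫⁻ t in Ioi 0, ENNReal.ofReal (t ^ (a - 1) * Real.exp (-(r * t))) =
      ENNReal.ofReal ((1 / r) ^ a * Real.Gamma a) := by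
  rw [← Real.integral_rpow_mul_exp_neg_mul_Ioi ha hr, ofReal_integral_eq_lintegral_ofReal]
  · apply Integrable.of_integral_ne_zero
    rw [Real.integral_rpow_mul_exp_neg_mul_Ioi ha hr]
    exact (mul_pos (by positivity) (Real.Gamma_pos_of_pos ha)).ne'
  · filter_upwards [ae_restrict_mem measurableSet_Ioi] with x hx
    exact mul_nonneg (Real.rpow_nonneg (le_of_lt hx) _) (Real.exp_pos _).le

lemma lintegral_rpow_mul_one_add_rpow_Ioi {a c : ℝ} (ha : 0 < a) (hac : a < c) :
    ∫⁻ u in Ioi 0, ENNReal.ofReal (u ^ (a - 1) * (1 + u) ^ (-c)) =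
      ENNReal.ofReal (Real.Gamma a * Real.Gamma (c - a) / Real.Gamma c) := by
  have hc : 0 < c := ha.trans hac
  have hΓ := Real.Gamma_pos_of_pos hc
  have key : ∫⁻ u in Ioi (0 : ℝ), ∫⁻ t in Ioi (0 : ℝ), ENNReal.ofReal
        (u ^ (a - 1) * (t ^ (c - 1) * Real.exp (-((1 + u) * t)))) =
      ENNReal.ofReal (Real.Gamma a * Real.Gamma (c - a)) := by
    rw [lintegral_lintegral_swap (by fun_prop)]
    calc _ = ∫⁻ t in Ioi (0 : ℝ), ENNReal.ofReal (Real.Gamma a) *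
          ENNReal.ofReal (t ^ (c - a - 1) * Real.exp (-(1 * t))) := by
          refine setLIntegral_congr_fun measurableSet_Ioi fun t ht => ?_
          have ht : 0 < t := ht
          calc _ = ∫⁻ u in Ioi (0 : ℝ), ENNReal.ofReal (t ^ (c - 1) * Real.exp (-t)) *
                ENNReal.ofReal (u ^ (a - 1) * Real.exp (-(t * u))) := by
                refine lintegral_congr fun u => ?_
                rw [← ENNReal.ofReal_mul (by positivity)]
                congr 1
                rw [show -((1 + u) * t) = -t + -(t * u) by ring, Real.exp_add]
                ring
            _ = _ := by
                rw [lintegral_const_mul _ (by fun_prop), lintegral_rpow_mul_exp_neg_mul_Ioi ha ht,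
                  ← ENNReal.ofReal_mul (by positivity),
                  ← ENNReal.ofReal_mul (Real.Gamma_pos_of_pos ha).le]
                congr 1
                rw [one_div, Real.inv_rpow ht.le, ← Real.rpow_neg ht.le,
                  show c - a - 1 = (c - 1) + -a by ring, Real.rpow_add ht, one_mul]
                ring
      _ = _ := by
          rw [lintegral_const_mul _ (by fun_prop),
            lintegral_rpow_mul_exp_neg_mul_Ioi (sub_pos.2 hac) one_pos,
            ← ENNReal.ofReal_mul (Real.Gamma_pos_of_pos ha).le]
          simp
  rw [div_eq_inv_mul, ENNReal.ofReal_mul (by positivity), ← key,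
    ← lintegral_const_mul _ (by fun_prop)]
  refine setLIntegral_congr_fun measurableSet_Ioi fun u hu => ?_
  have hu : 0 < u := hu
  simp_rw [ENNReal.ofReal_mul (Real.rpow_nonneg hu.le (a - 1))]
  rw [lintegral_const_mul _ (by fun_prop),
    lintegral_rpow_mul_exp_neg_mul_Ioi hc (by positivity), one_div, Real.inv_rpow (by positivity),
    ← Real.rpow_neg (by positivity), mul_comm _ (Real.Gamma c), ENNReal.ofReal_mul hΓ.le,
    mul_left_comm (ENNReal.ofReal (u ^ (a - 1))), ← mul_assoc,
    ← ENNReal.ofReal_mul (inv_pos.2 hΓ).le, ← ENNReal.ofReal_mul (by positivity),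
    inv_mul_cancel₀ hΓ.ne', ENNReal.ofReal_one, one_mul]

/-- The radial part of the integrand, after integrating out the scale. -/
noncomputable def betaKernel (a c u : ℝ) : ℝ :=
  u ^ (a - 1) * (1 + u) ^ (-c) * (min 1 u⁻¹) ^ (2 * a - c)

lemma measurable_betaKernel (a c : ℝ) : Measurable (betaKernel a c) := by
  unfold betaKernel
  fun_prop

lemma betaKernel_nonneg {a c u : ℝ} (hu : 0 < u) : 0 ≤ betaKernel a c u := by
  unfold betaKernel
  positivity

lemma betaKernel_le {a c u : ℝ} (hc : 0 < c) (ha : c / 2 ≤ a) (hu : 0 < u) :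
    betaKernel a c u ≤
      (Ioc 0 1).indicator (fun u => u ^ (c / 2 - 1)) u +
        (Ioi 1).indicator (fun u => u ^ (-(c / 2) - 1)) u := by
  unfold betaKernel
  rcases le_or_gt u 1 with h | h
  · have h1 : u ∉ Ioi (1 : ℝ) := by simpa using h
    have h2 : u ∈ Ioc (0 : ℝ) 1 := ⟨hu, h⟩
    rw [indicator_of_mem h2, indicator_of_notMem h1, add_zero,
      min_eq_left ((one_le_inv₀ hu).2 h), Real.one_rpow, mul_one]
    calc _ ≤ u ^ (c / 2 - 1) * 1 := by
          refine mul_le_mul (Real.rpow_le_rpow_of_exponent_ge hu h (by linarith))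
            (Real.rpow_le_one_of_one_le_of_nonpos (by linarith) (by linarith))
            (by positivity) (by positivity)
      _ = _ := mul_one _
  · have h1 : u ∈ Ioi (1 : ℝ) := h
    have h2 : u ∉ Ioc (0 : ℝ) 1 := fun h' => absurd h'.2 (not_le.2 h)
    rw [indicator_of_notMem h2, indicator_of_mem h1, zero_add,
      min_eq_right (inv_le_one_of_one_le₀ h.le), Real.inv_rpow hu.le, ← Real.rpow_neg hu.le]
    calc _ ≤ u ^ (a - 1) * u ^ (-c) * u ^ (-(2 * a - c)) := by
          refine mul_le_mul_of_nonneg_right (mul_le_mul_of_nonneg_left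
            (Real.rpow_le_rpow_of_nonpos hu (by linarith) (by linarith)) (by positivity))
            (by positivity)
      _ = u ^ (-a - 1) := by
          rw [← Real.rpow_add hu, ← Real.rpow_add hu]
          congr 1
          ring
      _ ≤ _ := Real.rpow_le_rpow_of_exponent_le h.le (by linarith)

lemma integrableOn_betaKernel_bound {c : ℝ} (hc : 0 < c) :
    IntegrableOn (fun u : ℝ => (Ioc 0 1).indicator (fun u => u ^ (c / 2 - 1)) u +
        (Ioi 1).indicator (fun u => u ^ (-(c / 2) - 1)) u) (Ioi 0) := by
  refine Integrable.integrableOn (Integrable.add ?_ ?_)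
  · rw [integrable_indicator_iff measurableSet_Ioc]
    exact (intervalIntegrable_iff_integrableOn_Ioc_of_le zero_le_one).1
      (intervalIntegral.intervalIntegrable_rpow' (by linarith))
  · rw [integrable_indicator_iff measurableSet_Ioi]
    exact integrableOn_Ioi_rpow_of_lt (by linarith) one_pos

lemma integrableOn_betaKernel {a c : ℝ} (hc : 0 < c) (ha : c / 2 ≤ a) :
    IntegrableOn (betaKernel a c) (Ioi 0) := by
  refine (integrableOn_betaKernel_bound hc).mono'
    (measurable_betaKernel a c).aestronglyMeasurable ?_
  filter_upwards [ae_restrict_mem measurableSet_Ioi] with u hu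
  rw [Real.norm_of_nonneg (betaKernel_nonneg hu)]
  exact betaKernel_le hc ha hu

lemma integral_betaKernel_half {c : ℝ} (hc : 0 < c) :
    ∫ u in Ioi 0, betaKernel (c / 2) c u =
      Real.Gamma (c / 2) * Real.Gamma (c / 2) / Real.Gamma c := by
  have hΓ := Real.Gamma_pos_of_pos hc
  have hΓ2 := Real.Gamma_pos_of_pos (half_pos hc)
  rw [integral_eq_lintegral_of_nonneg_ae]
  · have h := lintegral_rpow_mul_one_add_rpow_Ioi (half_pos hc) (half_lt_self hc)
    rw [sub_half] at h
    simp only [betaKernel, mul_div_cancel₀ c (two_ne_zero' ℝ), sub_self, Real.rpow_zero, mul_one, h]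
    exact ENNReal.toReal_ofReal (by positivity)
  · filter_upwards [ae_restrict_mem measurableSet_Ioi] with u hu using betaKernel_nonneg hu
  · exact (measurable_betaKernel _ c).aestronglyMeasurable

lemma tendsto_integral_betaKernel {c : ℝ} (hc : 0 < c) :
    Filter.Tendsto (fun a => ∫ u in Ioi 0, betaKernel a c u) (nhdsWithin (c / 2) (Ioi (c / 2)))
      (nhds (Real.Gamma (c / 2) * Real.Gamma (c / 2) / Real.Gamma c)) := by
  rw [← integral_betaKernel_half hc]
  refine tendsto_integral_filter_of_dominated_convergence _ ?_ ?_
    (integrableOn_betaKernel_bound hc) ?_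
  · exact Filter.Eventually.of_forall fun a => (measurable_betaKernel a c).aestronglyMeasurable
  · filter_upwards [self_mem_nhdsWithin] with a ha
    filter_upwards [ae_restrict_mem measurableSet_Ioi] with u hu
    rw [Real.norm_of_nonneg (betaKernel_nonneg hu)]
    exact betaKernel_le hc (le_of_lt ha) hu
  · filter_upwards [ae_restrict_mem measurableSet_Ioi] with u hu
    have hu : 0 < u := hu
    have hm : 0 < min 1 u⁻¹ := lt_min one_pos (inv_pos.2 hu)
    refine Filter.Tendsto.mono_left (ContinuousAt.tendsto ?_) nhdsWithin_le_nhds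
    unfold betaKernel
    exact ((Real.continuousAt_const_rpow hu.ne').comp' (by fun_prop)).mul continuousAt_const |>.mul
      ((Real.continuousAt_const_rpow hm.ne').comp' (by fun_prop))

lemma measurable_Gintegrand (γ α : ℝ) : Measurable (Gintegrand γ α) := by
  unfold Gintegrand
  fun_prop

lemma Gintegrand_nonneg (γ α : ℝ) (p : ℝ × ℝ) : 0 ≤ Gintegrand γ α p := by
  unfold Gintegrand
  positivity

lemma lintegral_Gintegrand_snd (γ α : ℝ) {x : ℝ} (hx : 0 < x) :
    ∫⁻ y in Ioo (-1) 0, ENNReal.ofReal (Gintegrand γ α (x, y)) =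
      ∫⁻ u in Ioo 0 x⁻¹, ENNReal.ofReal (x ^ (2 * (-(γ * α) / 2) - γ ^ 2 / 2 - 1) *
        (u ^ (-(γ * α) / 2 - 1) * (1 + u) ^ (-(γ ^ 2 / 2)))) := by
  have himg : (fun u => -x * u) '' Ioo 0 x⁻¹ = Ioo (-1) 0 := by
    rw [show (fun u : ℝ => -x * u) = Neg.neg ∘ (x * ·) from funext fun u => neg_mul x u, image_comp,
      image_mul_left_Ioo hx]
    simp [hx.ne']
  have hd : ∀ u ∈ Ioo 0 x⁻¹, HasDerivWithinAt (fun u => -x * u) (-x) (Ioo 0 x⁻¹) u := fun u _ => by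
    simpa using ((hasDerivAt_id u).const_mul (-x)).hasDerivWithinAt
  have hinj : InjOn (fun u => -x * u) (Ioo 0 x⁻¹) :=
    (mul_right_injective₀ (neg_ne_zero.2 hx.ne')).injOn
  rw [← himg, lintegral_image_eq_lintegral_abs_deriv_mul measurableSet_Ioo hd hinj]
  refine setLIntegral_congr_fun measurableSet_Ioo fun u hu => ?_
  have hu : 0 < u := hu.1
  rw [← ENNReal.ofReal_mul (abs_nonneg _)]
  congr 1
  simp only [Gintegrand]
  rw [show x - -x * u = x * (1 + u) by ring, abs_neg, abs_mul, abs_neg, abs_of_pos hx,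
    abs_of_pos hu, abs_of_pos (by positivity : 0 < x * (1 + u)), Real.mul_rpow hx.le hu.le,
    Real.mul_rpow hx.le (by positivity), neg_div 2 (γ ^ 2)]
  set a := -(γ * α) / 2
  set c := γ ^ 2 / 2
  rw [show 2 * a - c - 1 = 1 + (a - 1) + (a - 1) + -c by ring, Real.rpow_add hx,
    Real.rpow_add hx, Real.rpow_add hx, Real.rpow_one]
  ring

lemma lintegral_Gintegrand {γ α : ℝ} (h : γ ^ 2 / 2 < 2 * (-(γ * α) / 2)) :
    ∫⁻ p in (Ioo (0 : ℝ) 1) ×ˢ (Ioo (-1 : ℝ) 0), ENNReal.ofReal (Gintegrand γ α p) =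
      ENNReal.ofReal (1 / (2 * (-(γ * α) / 2) - γ ^ 2 / 2)) *
        ∫⁻ u in Ioi 0, ENNReal.ofReal (betaKernel (-(γ * α) / 2) (γ ^ 2 / 2) u) := by
  rw [Measure.volume_eq_prod, ← Measure.prod_restrict,
    lintegral_prod _ (measurable_Gintegrand γ α).ennreal_ofReal.aemeasurable,
    setLIntegral_congr_fun measurableSet_Ioo
      (fun x hx => lintegral_Gintegrand_snd γ α (mem_Ioo.1 hx).1)]
  set a := -(γ * α) / 2
  set c := γ ^ 2 / 2
  have hm : MeasurableSet {p : ℝ × ℝ | p.1 * p.2 < 1} :=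
    measurableSet_lt (by fun_prop) measurable_const
  let f : ℝ × ℝ → ENNReal := {p : ℝ × ℝ | p.1 * p.2 < 1}.indicator fun p =>
    ENNReal.ofReal (p.1 ^ (2 * a - c - 1) * (p.2 ^ (a - 1) * (1 + p.2) ^ (-c)))
  have hf : Measurable f := Measurable.indicator (by fun_prop) hm
  calc _ = ∫⁻ x in Ioo (0 : ℝ) 1, ∫⁻ u in Ioi (0 : ℝ), f (x, u) := by
        refine setLIntegral_congr_fun measurableSet_Ioo fun x hx => ?_
        rw [← Ioi_inter_Iio, inter_comm, ← setLIntegral_indicator measurableSet_Iio]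
        refine lintegral_congr fun u => ?_
        have : u < x⁻¹ ↔ x * u < 1 := by
          rw [← one_div, lt_div_iff₀' (mem_Ioo.1 hx).1]
        simp only [f, indicator, mem_Iio, mem_ofPred_eq, this]
    _ = ∫⁻ u in Ioi (0 : ℝ), ∫⁻ x in Ioo (0 : ℝ) 1, f (x, u) :=
        lintegral_lintegral_swap hf.aemeasurable
    _ = ∫⁻ u in Ioi (0 : ℝ), ENNReal.ofReal (1 / (2 * a - c)) *
          ENNReal.ofReal (betaKernel a c u) := by
        refine setLIntegral_congr_fun measurableSet_Ioi fun u hu => ?_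
        have hu : 0 < u := hu
        have hpos : 0 < 2 * a - c := sub_pos.2 h
        calc _ = ∫⁻ x in Ioo (0 : ℝ) (min 1 u⁻¹), ENNReal.ofReal (u ^ (a - 1) * (1 + u) ^ (-c)) *
              ENNReal.ofReal (x ^ (2 * a - c - 1)) := by
              rw [show Ioo 0 (min 1 u⁻¹) = Iio u⁻¹ ∩ Ioo 0 1 by
                  ext x; simp only [mem_Ioo, mem_inter_iff, mem_Iio, lt_min_iff]; tauto,
                ← setLIntegral_indicator measurableSet_Iio]
              refine lintegral_congr fun x => ?_
              have : x < u⁻¹ ↔ x * u < 1 := by rw [← one_div, lt_div_iff₀ hu]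
              simp only [f, indicator, mem_Iio, mem_ofPred_eq, this]
              congr 1
              rw [← ENNReal.ofReal_mul (by positivity), mul_comm]
          _ = _ := by
              rw [lintegral_const_mul _ (by fun_prop),
                lintegral_rpow_Ioo_zero (by linarith) (by positivity), sub_add_cancel,
                ← ENNReal.ofReal_mul (by positivity), ← ENNReal.ofReal_mul (by positivity)]
              unfold betaKernel
              congr 1
              ring
    _ = _ := lintegral_const_mul _ (measurable_betaKernel a c).ennreal_ofReal

lemma integrableOn_Gintegrand {γ α : ℝ} (hγ : 0 < γ) (h : γ ^ 2 / 2 < 2 * (-(γ * α) / 2)) :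
    IntegrableOn (Gintegrand γ α) ((Ioo (0 : ℝ) 1) ×ˢ (Ioo (-1 : ℝ) 0)) := by
  refine ⟨(measurable_Gintegrand γ α).aestronglyMeasurable, ?_⟩
  rw [hasFiniteIntegral_iff_ofReal (Filter.Eventually.of_forall (Gintegrand_nonneg γ α)),
    lintegral_Gintegrand h]
  refine ENNReal.mul_lt_top ENNReal.ofReal_lt_top ?_
  rw [← hasFiniteIntegral_iff_ofReal]
  · exact (integrableOn_betaKernel (by positivity) (by linarith)).hasFiniteIntegral
  · filter_upwards [ae_restrict_mem measurableSet_Ioi] with u hu using betaKernel_nonneg hu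

lemma G_eq {γ α : ℝ} (h : γ ^ 2 / 2 < 2 * (-(γ * α) / 2)) :
    G γ α = 1 / (2 * (-(γ * α) / 2) - γ ^ 2 / 2) *
      ∫ u in Ioi 0, betaKernel (-(γ * α) / 2) (γ ^ 2 / 2) u := by
  unfold G
  rw [integral_eq_lintegral_of_nonneg_ae (Filter.Eventually.of_forall (Gintegrand_nonneg γ α))
      (measurable_Gintegrand γ α).aestronglyMeasurable, lintegral_Gintegrand h, ENNReal.toReal_mul,
    ENNReal.toReal_ofReal (one_div_nonneg.2 (sub_pos.2 h).le), integral_eq_lintegral_of_nonneg_ae]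
  · filter_upwards [ae_restrict_mem measurableSet_Ioi] with u hu using betaKernel_nonneg hu
  · exact (measurable_betaKernel _ _).aestronglyMeasurable

lemma Gamma_sq_div_Gamma_two_mul {b : ℝ} (hb : 0 < b) (hb' : b < 1 / 2) :
    Real.Gamma b * Real.Gamma b / Real.Gamma (2 * b) =
      2 * (Real.cos (Real.pi * b) * Real.Gamma b * Real.Gamma (1 - 2 * b) /
        Real.Gamma (1 - b)) := by
  have h1 := Real.Gamma_mul_Gamma_one_sub b
  have h2 := Real.Gamma_mul_Gamma_one_sub (2 * b)
  have hs : 0 < Real.sin (Real.pi * b) :=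
    Real.sin_pos_of_pos_of_lt_pi (by positivity) (by nlinarith [Real.pi_pos])
  have hc : 0 < Real.cos (Real.pi * b) :=
    Real.cos_pos_of_mem_Ioo ⟨by nlinarith [Real.pi_pos], by nlinarith [Real.pi_pos]⟩
  have hΓ1 := Real.Gamma_pos_of_pos hb
  have hΓ2 := Real.Gamma_pos_of_pos (by linarith : 0 < 2 * b)
  have hΓ3 := Real.Gamma_pos_of_pos (by linarith : 0 < 1 - b)
  rw [show Real.pi * (2 * b) = 2 * (Real.pi * b) by ring, Real.sin_two_mul,
    eq_div_iff (by positivity)] at h2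
  rw [eq_div_iff hs.ne'] at h1
  rw [mul_div_assoc', div_eq_div_iff hΓ2.ne' hΓ3.ne']
  refine mul_right_cancel₀ hs.ne' ?_
  linear_combination Real.Gamma b * h1 - Real.Gamma b * h2

theorem stmt4 (γ : ℝ) (hγ0 : 0 < γ) (hγ2 : γ < Real.sqrt 2) :
    (∀ α : ℝ, α < -γ / 2 →
      IntegrableOn (Gintegrand γ α) ((Ioo (0 : ℝ) 1) ×ˢ (Ioo (-1 : ℝ) 0)) volume) ∧
    Filter.Tendsto (fun α : ℝ => (α + γ / 2) * G γ α)
      (nhdsWithin (-γ / 2) (Iio (-γ / 2)))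
      (nhds (-(2 / γ) * Real.cos (Real.pi * γ ^ 2 / 4) *
        Real.Gamma (γ ^ 2 / 4) * Real.Gamma (1 - γ ^ 2 / 2) /
        Real.Gamma (1 - γ ^ 2 / 4))) := by
  have hsq : γ ^ 2 < 2 := (Real.lt_sqrt hγ0.le).1 hγ2
  have hα : ∀ α : ℝ, α < -γ / 2 → γ ^ 2 / 2 < 2 * (-(γ * α) / 2) := fun α h => by
    nlinarith [mul_lt_mul_of_pos_left h hγ0]
  refine ⟨fun α h => integrableOn_Gintegrand hγ0 (hα α h), ?_⟩
  have hlim : Filter.Tendsto (fun α : ℝ => -(γ * α) / 2) (nhdsWithin (-γ / 2) (Iio (-γ / 2)))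
      (nhdsWithin (γ ^ 2 / 2 / 2) (Ioi (γ ^ 2 / 2 / 2))) := by
    refine tendsto_nhdsWithin_of_tendsto_nhds_of_eventually_within _ ?_ ?_
    · have : Continuous fun α : ℝ => -(γ * α) / 2 := by fun_prop
      refine ((this.tendsto' (-γ / 2) _ ?_).mono_left nhdsWithin_le_nhds)
      ring
    · filter_upwards [self_mem_nhdsWithin] with α h
      have := hα α h
      rw [mem_Ioi]
      linarith
  have hmain := ((tendsto_integral_betaKernel (by positivity : 0 < γ ^ 2 / 2)).comp hlim).const_mul
    (-(1 / γ))
  have hval : -(1 / γ) * (Real.Gamma (γ ^ 2 / 2 / 2) * Real.Gamma (γ ^ 2 / 2 / 2) /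
      Real.Gamma (γ ^ 2 / 2)) = -(2 / γ) * Real.cos (Real.pi * γ ^ 2 / 4) *
        Real.Gamma (γ ^ 2 / 4) * Real.Gamma (1 - γ ^ 2 / 2) /
        Real.Gamma (1 - γ ^ 2 / 4) := by
    have := Gamma_sq_div_Gamma_two_mul (b := γ ^ 2 / 4) (by positivity) (by linarith)
    rw [show 2 * (γ ^ 2 / 4) = γ ^ 2 / 2 by ring, ← mul_div_assoc Real.pi] at this
    rw [show γ ^ 2 / 2 / 2 = γ ^ 2 / 4 by ring, this]
    ring
  rw [hval] at hmain
  refine hmain.congr' ?_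
  filter_upwards [self_mem_nhdsWithin] with α h
  have hd : 2 * (-(γ * α) / 2) - γ ^ 2 / 2 = -γ * (α + γ / 2) := by ring
  have hne : α + γ / 2 ≠ 0 := by
    have : α < -γ / 2 := h
    linarith
  rw [G_eq (hα α h), hd, Function.comp_apply, ← mul_assoc]
  congr 1
  generalize α + γ / 2 = s at hne
  field_simp
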